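/- Suppose f is monotone in interference and let [a₁,b₁], …, [a_J,b_J] be finitely many rectangles contained in [a₀,b₀] whose sliced feasible sets cover S_{[a₀,b₀]} (i.e., every Q ∈ S with a₀ ≤ g(Q) ≤ b₀ lies in some S_{[a_j,b_j]}). Assume each S_{[a_j,b_j]} is nonempty and admits a minimizer Q*_j of f(·, a_j). Then min_{1 ≤ j ≤ J} L_B([a_j,b_j]) ≤ inf_{Q ∈ S_{[a₀,b₀]}} f(Q, g(Q)) ≤ min_{1 ≤ j ≤ J} U_B([a_j,b_j]); i.e., the branch-and-bound partition sandwiches the global optimal value of problem (P). -/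

import Mathlib

/-- The branch-and-bound partition sandwiches the global optimal value of
problem (P): if rectangles `[a_j, b_j] ⊆ [a₀, b₀]`, `j = 1, …, J`, are such that
the sliced feasible sets `S_{[a_j,b_j]}` cover `S_{[a₀,b₀]}`, then
`min_j L_B([a_j,b_j]) ≤ inf_{Q ∈ S_{[a₀,b₀]}} f(Q, g(Q)) ≤ min_j U_B([a_j,b_j])`. -/
theorem partition_sandwiches_optimum {n L J : ℕ} (hJ : 0 < J)
    (S : Set (Fin n → ℝ))
    (g : (Fin n → ℝ) → (Fin L → ℝ))
    (f : (Fin n → ℝ) → (Fin L → ℝ) → ℝ)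
    (hmono : ∀ (Q : Fin n → ℝ) (i i' : Fin L → ℝ), i ≤ i' → f Q i ≤ f Q i')
    (a₀ b₀ : Fin L → ℝ)
    (a b : Fin J → (Fin L → ℝ))
    (hrect : ∀ j, a₀ ≤ a j ∧ a j ≤ b j ∧ b j ≤ b₀)
    (hcover : ∀ Q ∈ {Q ∈ S | a₀ ≤ g Q ∧ g Q ≤ b₀},
      ∃ j, a j ≤ g Q ∧ g Q ≤ b j)
    (Qstar : Fin J → (Fin n → ℝ))
    (hQmem : ∀ j, Qstar j ∈ {Q ∈ S | a j ≤ g Q ∧ g Q ≤ b j})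
    (hQmin : ∀ j, ∀ Q ∈ {Q ∈ S | a j ≤ g Q ∧ g Q ≤ b j},
      f (Qstar j) (a j) ≤ f Q (a j)) :
    (⨅ j : Fin J, f (Qstar j) (a j)) ≤
        sInf ((fun Q => f Q (g Q)) '' {Q ∈ S | a₀ ≤ g Q ∧ g Q ≤ b₀}) ∧
      sInf ((fun Q => f Q (g Q)) '' {Q ∈ S | a₀ ≤ g Q ∧ g Q ≤ b₀}) ≤
        ⨅ j : Fin J, f (Qstar j) (g (Qstar j)) := by
  have : Nonempty (Fin J) := ⟨⟨0, hJ⟩⟩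
  have hmem : ∀ j, f (Qstar j) (g (Qstar j)) ∈
      (fun Q => f Q (g Q)) '' {Q ∈ S | a₀ ≤ g Q ∧ g Q ≤ b₀} := fun j =>
    ⟨Qstar j, ⟨(hQmem j).1, (hrect j).1.trans (hQmem j).2.1,
      (hQmem j).2.2.trans (hrect j).2.2⟩, rfl⟩
  have hlb : ∀ y ∈ (fun Q => f Q (g Q)) '' {Q ∈ S | a₀ ≤ g Q ∧ g Q ≤ b₀},
      (⨅ j : Fin J, f (Qstar j) (a j)) ≤ y := by
    rintro _ ⟨Q, hQ, rfl⟩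
    obtain ⟨j, haj, hbj⟩ := hcover Q hQ
    calc (⨅ j : Fin J, f (Qstar j) (a j)) ≤ f (Qstar j) (a j) :=
          ciInf_le (Set.finite_range _).bddBelow j
      _ ≤ f Q (a j) := hQmin j Q ⟨hQ.1, haj, hbj⟩
      _ ≤ f Q (g Q) := hmono Q _ _ haj
  exact ⟨le_csInf ⟨_, hmem ⟨0, hJ⟩⟩ hlb, le_ciInf fun j => csInf_le ⟨_, hlb⟩ (hmem j)⟩
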